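/- arXiv:2308.10332 — 13 statements merged into one kernel-verified Lean document; each statement's English description precedes it below -/
import Mathlib

section
/- In End(ℂ[x]), for all m, n ∈ ℕ one has the anti-normal-to-normal ordering identity A^m ∘ C^n = Σ_{ℓ=0}^{min(m,n)} ℓ! · C(m,ℓ) · C(n,ℓ) · C^{n−ℓ} ∘ A^{m−ℓ}, where C(m,ℓ) denotes the binomial coefficient. -/
open Polynomial

/-- The differentiation operator `d/dx` on `ℂ[x]`, as a `ℂ`-linear endomorphism. -/
noncomputable def A : Module.End ℂ (Polynomial ℂ) := Polynomial.derivative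

/-- The operator of multiplication by `x` on `ℂ[x]`, as a `ℂ`-linear endomorphism. -/
noncomputable def C : Module.End ℂ (Polynomial ℂ) := LinearMap.mulLeft ℂ Polynomial.X

theorem A_pow_apply (k : ℕ) (p : Polynomial ℂ) : (A ^ k) p = derivative^[k] p :=
  Module.End.pow_apply _ _ _

theorem C_pow_apply (k : ℕ) (p : Polynomial ℂ) : (_root_.C ^ k) p = X ^ k * p := by
  rw [_root_.C, LinearMap.pow_mulLeft, LinearMap.mulLeft_apply]

/-- Anti-normal-to-normal ordering:
`A^m ∘ C^n = Σ_{ℓ=0}^{min(m,n)} ℓ! · C(m,ℓ) · C(n,ℓ) · C^{n−ℓ} ∘ A^{m−ℓ}`. -/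
theorem antinormal_to_normal (m n : ℕ) :
    A ^ m * C ^ n =
      ∑ ℓ ∈ Finset.range (min m n + 1),
        ((Nat.factorial ℓ * Nat.choose m ℓ * Nat.choose n ℓ : ℕ) : ℂ) •
          (C ^ (n - ℓ) * A ^ (m - ℓ)) := by
  refine LinearMap.ext fun p ↦ ?_
  rw [Module.End.mul_apply, C_pow_apply, A_pow_apply, mul_comm, iterate_derivative_mul_X_pow,
    min_comm n m, LinearMap.sum_apply]
  refine Finset.sum_congr rfl fun ℓ _ ↦ ?_
  rw [LinearMap.smul_apply, Module.End.mul_apply, C_pow_apply, A_pow_apply,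
    Nat.cast_smul_eq_nsmul, Nat.descFactorial_eq_factorial_mul_choose, mul_left_comm,
    ← mul_assoc, mul_comm (derivative^[m - ℓ] p)]
end

section
/- For all α, β, r ∈ ℂ, n ∈ ℕ, and every natural number x, one has the forward binomial-transform identity (βx+r)^{\underline{n},α} = Σ_{k=0}^{n} Ŝ_{n,k}(α,β;r) · C(x,k), where C(x,k) is the binomial coefficient. -/
/-- Falling factorial with stride `α`: `(r)^{\underline{m},α} = ∏_{i=0}^{m-1} (r - iα)`. -/
noncomputable def ffall (r α : ℂ) (m : ℕ) : ℂ := ∏ i ∈ Finset.range m, (r - i * α)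

/-- Modified generalized Stirling numbers
`Ŝ_{n,k}(α,β;r) = Σ_{x=0}^{k} (−1)^{k−x} C(k,x) (βx+r)^{\underline{n},α}`. -/
noncomputable def Shat (α β r : ℂ) (n k : ℕ) : ℂ :=
  ∑ x ∈ Finset.range (k + 1), (-1) ^ (k - x) * (Nat.choose k x : ℂ) * ffall (β * x + r) α n

/-- Generalized Eulerian numbers
`E_{n,k}(α,β;r) = Σ_{x=0}^{k} (−1)^{k−x} C(n+1,k−x) (βx+r)^{\underline{n},α}`. -/
noncomputable def Egen (α β r : ℂ) (n k : ℕ) : ℂ :=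
  ∑ x ∈ Finset.range (k + 1), (-1) ^ (k - x) * (Nat.choose (n + 1) (k - x) : ℂ) * ffall (β * x + r) α n


open Polynomial in
/-- The map `z ↦ (βz + r)^{\underline{n},α}` is a polynomial function of degree at most `n`. -/
lemma exists_polynomial_eval_eq_ffall (α β r : ℂ) (n : ℕ) :
    ∃ P : ℂ[X], P.natDegree ≤ n ∧ P.eval = fun z ↦ ffall (β * z + r) α n := by
  refine ⟨∏ i ∈ Finset.range n, (C β * X + C (r - i * α)), ?_, ?_⟩
  · refine (natDegree_prod_le _ _).trans ((Finset.sum_le_card_nsmul _ _ 1 fun i _ ↦ ?_).trans ?_)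
    · exact natDegree_linear_le
    · simp
  · ext z
    simp [ffall, eval_prod, add_sub_assoc]

/-- The numbers `Ŝ_{n,k}(α,β;r)` are the forward differences at `0` of
`z ↦ (βz + r)^{\underline{n},α}`. -/
lemma Shat_eq_fwdDiff_iter (α β r : ℂ) (n k : ℕ) :
    Shat α β r n k = (fwdDiff 1)^[k] (fun z : ℂ ↦ ffall (β * z + r) α n) 0 := by
  simp [Shat, fwdDiff_iter_eq_sum_shift]

lemma Shat_eq_zero_of_lt (α β r : ℂ) {n k : ℕ} (h : n < k) : Shat α β r n k = 0 := by
  obtain ⟨P, hdeg, hP⟩ := exists_polynomial_eval_eq_ffall α β r n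
  rw [Shat_eq_fwdDiff_iter, ← hP,
    Polynomial.fwdDiff_iter_eq_zero_of_degree_lt (hdeg.trans_lt h), Pi.zero_apply]

/-- Forward binomial-transform identity:
`(βx+r)^{\underline{n},α} = Σ_{k=0}^{n} Ŝ_{n,k}(α,β;r) · C(x,k)`. -/
theorem ffall_eq_sum_Shat (α β r : ℂ) (n x : ℕ) :
    ffall (β * x + r) α n =
      ∑ k ∈ Finset.range (n + 1), Shat α β r n k * (Nat.choose x k : ℂ) := by
  have newton : ffall (β * x + r) α n =
      ∑ k ∈ Finset.range (x + 1), Shat α β r n k * (Nat.choose x k : ℂ) := by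
    simpa [Shat_eq_fwdDiff_iter, mul_comm] using
      shift_eq_sum_fwdDiff_iter (1 : ℂ) (fun z ↦ ffall (β * z + r) α n) x 0
  rw [newton]
  rcases le_total x n with h | h
  · refine Finset.sum_subset (Finset.range_mono (by lia)) fun k _ hk ↦ ?_
    rw [Nat.choose_eq_zero_of_lt (by simpa using hk), Nat.cast_zero, mul_zero]
  · refine (Finset.sum_subset (Finset.range_mono (by lia)) fun k _ hk ↦ ?_).symm
    rw [Shat_eq_zero_of_lt α β r (by simpa using hk), zero_mul]
end

section
/- For all α, β, r ∈ ℂ, n ∈ ℕ, and every natural number x, one has the generalized Worpitzky identity (βx+r)^{\underline{n},α} = Σ_{k=0}^{n} E_{n,k}(α,β;r) · C(x+n−k, n), where C(x+n−k,n) is the binomial coefficient. -/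
theorem PowerSeries.coeff_one_sub_X_pow {R : Type*} [CommRing R] (m k : ℕ) :
    PowerSeries.coeff k ((1 - PowerSeries.X : PowerSeries R) ^ m) =
      (-1) ^ k * (Nat.choose m k : R) := by
  induction m generalizing k with
  | zero => cases k <;> simp [PowerSeries.coeff_one]
  | succ m ih =>
    rw [pow_succ, mul_sub, mul_one, map_sub]
    cases k with
    | zero => simp
    | succ k =>
      rw [PowerSeries.coeff_succ_mul_X, ih, ih, Nat.choose_succ_succ]
      push_cast
      ring

/-- The stride-`α` falling factorial of `β y + r`, as a polynomial in `y`. -/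
noncomputable def ffallPoly (α β r : ℂ) (n : ℕ) : Polynomial ℂ :=
  ∏ i ∈ Finset.range n, (Polynomial.C β * Polynomial.X + Polynomial.C (r - i * α))

theorem eval_ffallPoly (α β r y : ℂ) (n : ℕ) :
    (ffallPoly α β r n).eval y = ffall (β * y + r) α n := by
  simp [ffallPoly, ffall, Polynomial.eval_prod, add_sub_assoc]

theorem natDegree_ffallPoly_le (α β r : ℂ) (n : ℕ) : (ffallPoly α β r n).natDegree ≤ n := by
  refine (Polynomial.natDegree_prod_le _ _).trans ?_
  refine (Finset.sum_le_sum fun i _ => Polynomial.natDegree_linear_le).trans ?_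
  simp

theorem Egen_eq_zero_of_lt (α β r : ℂ) {n k : ℕ} (h : n < k) : Egen α β r n k = 0 := by
  obtain ⟨d, rfl⟩ := Nat.exists_eq_add_of_le' (Nat.succ_le_of_lt h)
  have key := congrFun (Polynomial.fwdDiff_iter_eq_zero_of_degree_lt
    (Nat.lt_succ_of_le (natDegree_ffallPoly_le α β r n))) (d : ℂ)
  rw [fwdDiff_iter_eq_sum_shift, Pi.zero_apply] at key
  rw [Egen, add_assoc, Finset.sum_range_add, ← key, Finset.sum_eq_zero, zero_add]
  · refine Finset.sum_congr rfl fun i hi => ?_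
    have hi' : i ≤ n + 1 := Nat.lt_succ_iff.mp (Finset.mem_range.mp hi)
    rw [eval_ffallPoly, Nat.succ_eq_add_one, Nat.add_sub_add_left, Nat.choose_symm hi']
    simp
  · intro x hx
    rw [Nat.choose_eq_zero_of_lt (by have := Finset.mem_range.mp hx; omega)]
    simp

theorem mk_Egen (α β r : ℂ) (n : ℕ) :
    PowerSeries.mk (Egen α β r n) =
      PowerSeries.mk (fun x : ℕ => ffall (β * x + r) α n) * (1 - PowerSeries.X) ^ (n + 1) := by
  ext k
  rw [PowerSeries.coeff_mul, Finset.Nat.sum_antidiagonal_eq_sum_range_succ_mk]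
  simp only [PowerSeries.coeff_mk, PowerSeries.coeff_one_sub_X_pow, Egen]
  exact Finset.sum_congr rfl fun x _ => mul_comm _ _

/-- Generalized Worpitzky identity:
`(βx+r)^{\underline{n},α} = Σ_{k=0}^{n} E_{n,k}(α,β;r) · C(x+n−k, n)`. -/
theorem ffall_eq_sum_Egen (α β r : ℂ) (n x : ℕ) :
    ffall (β * x + r) α n =
      ∑ k ∈ Finset.range (n + 1), Egen α β r n k * (Nat.choose (x + n - k) n : ℂ) := by
  have h : PowerSeries.mk (fun x : ℕ => ffall (β * x + r) α n) =
      PowerSeries.mk (Egen α β r n) * PowerSeries.mk fun j => (Nat.choose (n + j) n : ℂ) := by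
    rw [mk_Egen, mul_assoc, mul_comm (_ ^ _), PowerSeries.mk_add_choose_mul_one_sub_pow_eq_one,
      mul_one]
  have hx := congrArg (PowerSeries.coeff x) h
  rw [PowerSeries.coeff_mul, Finset.Nat.sum_antidiagonal_eq_sum_range_succ_mk] at hx
  simp only [PowerSeries.coeff_mk] at hx
  have hle : ∀ m, m ≤ n + x →
      (∀ k, m < k → k ≤ n + x → Egen α β r n k * (Nat.choose (x + n - k) n : ℂ) = 0) →
      ∑ k ∈ Finset.range (m + 1), Egen α β r n k * (Nat.choose (x + n - k) n : ℂ) =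
        ∑ k ∈ Finset.range (n + x + 1), Egen α β r n k * (Nat.choose (x + n - k) n : ℂ) := by
    intro m hm h0
    refine Finset.sum_subset (Finset.range_subset_range.mpr (by omega)) fun k hk hk' => ?_
    simp only [Finset.mem_range] at hk hk'
    exact h0 k (by omega) (by omega)
  rw [hx, hle n (by omega) fun k hk _ => by rw [Egen_eq_zero_of_lt α β r hk, zero_mul],
    ← hle x (by omega) fun k hk _ => by
      rw [Nat.choose_eq_zero_of_lt (by omega), Nat.cast_zero, mul_zero]]
  refine Finset.sum_congr rfl fun k hk => ?_
  have hk' := Finset.mem_range.mp hk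
  rw [show n + (x - k) = x + n - k by omega]
end

section
/- For all α, β, r ∈ ℂ and all n, k ∈ ℕ with k ≤ n, one has E_{n,k}(α,β;r) = Σ_{j=0}^{k} (−1)^{k−j} C(n−j, n−k) · Ŝ_{n,j}(α,β;r); that is, each row of the generalized Eulerian triangle is the inverse binomial transform of the corresponding row of the modified generalized Stirling triangle. -/
/-- A dual Vandermonde identity: `Σ_{j=0}^{n} C(n-j,m) C(j,x) = C(n+1,m+x+1)`. -/
theorem sum_range_choose_sub_mul_choose (n m x : ℕ) :
    ∑ j ∈ Finset.range (n + 1), (n - j).choose m * j.choose x = (n + 1).choose (m + x + 1) := by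
  induction n generalizing m with
  | zero => cases m <;> cases x <;> simp [Nat.choose_eq_zero_of_lt]
  | succ n ih =>
    cases m with
    | zero =>
      have h := ih 0
      simp only [Nat.choose_zero_right, one_mul, zero_add] at h ⊢
      rw [Finset.sum_range_succ, h, Nat.choose_succ_succ' (n + 1) x, add_comm]
    | succ m =>
      rw [Finset.sum_range_succ, Nat.sub_self, Nat.choose_zero_succ, zero_mul, add_zero,
        show m + 1 + x + 1 = (m + x + 1) + 1 by ring, Nat.choose_succ_succ' (n + 1), ← ih m,
        show m + x + 1 + 1 = (m + 1) + x + 1 by ring, ← ih (m + 1), ← Finset.sum_add_distrib]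
      refine Finset.sum_congr rfl fun j hj => ?_
      rw [Nat.succ_sub (Nat.lt_succ_iff.mp (Finset.mem_range.mp hj)), Nat.choose_succ_succ, add_mul]

theorem sum_range_choose_sub_sub_mul_choose {n k x : ℕ} (hk : k ≤ n) (hx : x ≤ k) :
    ∑ j ∈ Finset.range (k + 1), (n - j).choose (n - k) * j.choose x =
      (n + 1).choose (k - x) := by
  rw [Finset.sum_subset (Finset.range_subset_range.mpr (Nat.succ_le_succ hk)),
    sum_range_choose_sub_mul_choose]
  · exact Nat.choose_symm_of_eq_add (by omega)
  · intro j hj hjk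
    rw [Finset.mem_range] at hj hjk
    rw [Nat.choose_eq_zero_of_lt (by omega), zero_mul]

theorem Shat_eq_sum_range {α β r : ℂ} {n j k : ℕ} (hj : j ≤ k) :
    Shat α β r n j = ∑ x ∈ Finset.range (k + 1),
      (-1) ^ (j - x) * (Nat.choose j x : ℂ) * ffall (β * x + r) α n := by
  refine Finset.sum_subset (Finset.range_subset_range.mpr (Nat.succ_le_succ hj)) fun x _ hx => ?_
  rw [Finset.mem_range] at hx
  rw [Nat.choose_eq_zero_of_lt (by omega), Nat.cast_zero, mul_zero, zero_mul]

/-- Each row of the generalized Eulerian triangle is the inverse binomial transform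
of the corresponding row of the modified generalized Stirling triangle:
`E_{n,k} = Σ_{j=0}^{k} (−1)^{k−j} C(n−j, n−k) Ŝ_{n,j}`. -/
theorem Egen_eq_inverse_binomial_transform_Shat (α β r : ℂ) (n k : ℕ) (hk : k ≤ n) :
    Egen α β r n k =
      ∑ j ∈ Finset.range (k + 1),
        (-1) ^ (k - j) * (Nat.choose (n - j) (n - k) : ℂ) * Shat α β r n j := by
  have expand : ∀ j ∈ Finset.range (k + 1),
      (-1) ^ (k - j) * (Nat.choose (n - j) (n - k) : ℂ) * Shat α β r n j =
        ∑ x ∈ Finset.range (k + 1), (-1) ^ (k - x) *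
          (((n - j).choose (n - k) * j.choose x : ℕ) : ℂ) * ffall (β * x + r) α n := by
    intro j hj
    have hjk : j ≤ k := Nat.lt_succ_iff.mp (Finset.mem_range.mp hj)
    rw [Shat_eq_sum_range hjk, Finset.mul_sum]
    refine Finset.sum_congr rfl fun x _ => ?_
    rcases lt_or_ge j x with hx | hx
    · simp [Nat.choose_eq_zero_of_lt hx]
    · rw [show k - x = (k - j) + (j - x) by omega, pow_add]
      push_cast
      ring
  rw [Finset.sum_congr rfl expand, Finset.sum_comm, Egen]
  refine Finset.sum_congr rfl fun x hx => ?_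
  rw [← Finset.sum_mul, ← Finset.mul_sum, ← Nat.cast_sum,
    sum_range_choose_sub_sub_mul_choose hk (Nat.lt_succ_iff.mp (Finset.mem_range.mp hx))]
end

section
/- For all α, β, r ∈ ℂ and all n, k ∈ ℕ, the modified generalized Stirling numbers satisfy the triangular (GKP-type) recurrence Ŝ_{n+1,k+1}(α,β;r) = (−αn + β(k+1) + r) · Ŝ_{n,k+1}(α,β;r) + β(k+1) · Ŝ_{n,k}(α,β;r). -/
/-- The last factor of the falling factorial splits off. -/
theorem ffall_succ (r α : ℂ) (m : ℕ) : ffall r α (m + 1) = ffall r α m * (r - m * α) :=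
  Finset.prod_range_succ _ _

/-- GKP-type triangular recurrence for the modified generalized Stirling numbers:
`Ŝ_{n+1,k+1} = (−αn + β(k+1) + r) Ŝ_{n,k+1} + β(k+1) Ŝ_{n,k}`. -/
theorem Shat_recurrence (α β r : ℂ) (n k : ℕ) :
    Shat α β r (n + 1) (k + 1) =
      (-(α * n) + β * (k + 1) + r) * Shat α β r n (k + 1)
        + β * (k + 1) * Shat α β r n k := by
  simp only [Shat, ffall_succ]
  rw [Finset.sum_range_succ _ (k + 1), Finset.sum_range_succ _ (k + 1), mul_add, Finset.mul_sum,
    Finset.mul_sum, add_right_comm, ← Finset.sum_add_distrib]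
  congr 1
  · refine Finset.sum_congr rfl fun x hx => ?_
    have hxk : x ≤ k := Nat.lt_succ_iff.mp (Finset.mem_range.mp hx)
    have hchoose : (k.choose x : ℂ) * (k + 1) = (k + 1).choose x * (k + 1 - x) := by
      have h := congrArg (Nat.cast : ℕ → ℂ) (Nat.choose_mul_succ_eq k x)
      push_cast [Nat.cast_sub (hxk.trans k.le_succ)] at h
      exact h
    rw [Nat.succ_sub hxk, pow_succ]
    linear_combination -(β * (-1) ^ (k - x) * ffall (β * x + r) α n) * hchoose
  · push_cast
    ring
end

section
/- For all α, β, r ∈ ℂ, every n ∈ ℕ, and every x ∈ ℂ, the Hsu–Shiue generalized Stirling numbers satisfy the connection identity (x)^{\underline{n},α} = Σ_{k=0}^{n} S_{n,k}(α,β;r) · (x − r)^{\underline{k},β}. -/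
/-- The Hsu–Shiue generalized Stirling numbers `S_{n,k}(α,β;r)`, defined by the
triangular recurrence `S_{0,0} = 1`, `S_{0,k+1} = 0`, `S_{n+1,0} = (r − αn) S_{n,0}`,
`S_{n+1,k+1} = (−αn + β(k+1) + r) S_{n,k+1} + S_{n,k}` (whence `S_{n,k} = 0` for `k > n`). -/
noncomputable def HS (α β r : ℂ) : ℕ → ℕ → ℂ
  | 0, 0 => 1
  | 0, _ + 1 => 0
  | n + 1, 0 => (r - α * n) * HS α β r n 0
  | n + 1, k + 1 => (-(α * n) + β * (k + 1) + r) * HS α β r n (k + 1) + HS α β r n k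

theorem HS_eq_zero_of_lt (α β r : ℂ) {n k : ℕ} (h : n < k) : HS α β r n k = 0 := by
  induction n generalizing k with
  | zero =>
    obtain ⟨k, rfl⟩ := Nat.exists_eq_succ_of_ne_zero h.ne'
    simp [HS]
  | succ n ih =>
    obtain ⟨k, rfl⟩ := Nat.exists_eq_succ_of_ne_zero (Nat.ne_zero_of_lt h)
    simp [HS, ih (show n < k + 1 by omega), ih (show n < k by omega)]

/-- Connection identity defining the Hsu–Shiue generalized Stirling numbers:
`(x)^{\underline{n},α} = Σ_{k=0}^{n} S_{n,k}(α,β;r) (x − r)^{\underline{k},β}`. -/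
theorem HS_connection (α β r : ℂ) (n : ℕ) (x : ℂ) :
    ffall x α n = ∑ k ∈ Finset.range (n + 1), HS α β r n k * ffall (x - r) β k := by
  induction n with
  | zero => simp [ffall, HS]
  | succ n ih =>
    have shift : ∑ k ∈ Finset.range (n + 1),
        (-(α * n) + β * k + r) * HS α β r n k * ffall (x - r) β k =
        ∑ k ∈ Finset.range (n + 1),
          (-(α * n) + β * (k + 1) + r) * HS α β r n (k + 1) * ffall (x - r) β (k + 1) +
        (r - α * n) * HS α β r n 0 * ffall (x - r) β 0 := by
      have h := Finset.sum_range_succ'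
        (fun k : ℕ => (-(α * n) + β * k + r) * HS α β r n k * ffall (x - r) β k) (n + 1)
      rw [Finset.sum_range_succ, HS_eq_zero_of_lt α β r n.lt_succ_self] at h
      push_cast at h
      linear_combination h
    have recurrence : ∑ k ∈ Finset.range (n + 2), HS α β r (n + 1) k * ffall (x - r) β k =
        ∑ k ∈ Finset.range (n + 1), (-(α * n) + β * k + r) * HS α β r n k * ffall (x - r) β k +
        ∑ k ∈ Finset.range (n + 1), HS α β r n k * ffall (x - r) β (k + 1) := by
      rw [Finset.sum_range_succ', shift, add_right_comm, ← Finset.sum_add_distrib]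
      simp only [HS, add_mul _ (HS α β r n _)]
    rw [recurrence, ffall_succ, ih, Finset.sum_mul, ← Finset.sum_add_distrib]
    refine Finset.sum_congr rfl fun k _ => ?_
    rw [ffall_succ]
    ring
end

section
/- For all α, β, γ, r₁, r₂ ∈ ℂ and all n, k ∈ ℕ with k ≤ n, the Hsu–Shiue generalized Stirling numbers satisfy the matrix product rule S_{n,k}(α,γ; r₁+r₂) = Σ_{j=k}^{n} S_{n,j}(α,β; r₁) · S_{j,k}(β,γ; r₂). -/
/-- The recurrence of the rows of `HS`, paired with an arbitrary sequence. -/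
theorem sum_HS_succ_mul (α β r : ℂ) (n : ℕ) (f : ℕ → ℂ) :
    ∑ j ∈ Finset.range (n + 2), HS α β r (n + 1) j * f j =
      ∑ j ∈ Finset.range (n + 1),
        HS α β r n j * ((-(α * n) + β * j + r) * f j + f (j + 1)) := by
  have shift : ∑ j ∈ Finset.range (n + 1), HS α β r n j * ((-(α * n) + β * j + r) * f j) =
      ∑ j ∈ Finset.range (n + 2), HS α β r n j * ((-(α * n) + β * j + r) * f j) := by
    rw [Finset.sum_range_succ _ (n + 1), HS_eq_zero_of_lt α β r n.lt_succ_self, zero_mul,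
      add_zero]
  simp only [mul_add (HS α β r n _), Finset.sum_add_distrib]
  rw [shift, Finset.sum_range_succ', Finset.sum_range_succ' _ (n + 1), add_right_comm,
    ← Finset.sum_add_distrib]
  congr 1
  · refine Finset.sum_congr rfl fun j _ => ?_
    rw [HS]
    push_cast
    ring
  · rw [HS]
    push_cast
    ring

theorem HS_add_eq_sum_range (α β γ r₁ r₂ : ℂ) (n k : ℕ) :
    HS α γ (r₁ + r₂) n k =
      ∑ j ∈ Finset.range (n + 1), HS α β r₁ n j * HS β γ r₂ j k := by
  induction n generalizing k with
  | zero => cases k <;> simp [HS]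
  | succ n ih =>
    rw [sum_HS_succ_mul]
    cases k with
    | zero =>
      rw [HS, ih, Finset.mul_sum]
      refine Finset.sum_congr rfl fun j _ => ?_
      rw [HS]
      ring
    | succ k =>
      rw [HS, ih, ih, Finset.mul_sum, ← Finset.sum_add_distrib]
      refine Finset.sum_congr rfl fun j _ => ?_
      rw [HS]
      ring

/-- Matrix product rule for the Hsu–Shiue generalized Stirling numbers:
`S_{n,k}(α,γ; r₁+r₂) = Σ_{j=k}^{n} S_{n,j}(α,β; r₁) S_{j,k}(β,γ; r₂)`. -/
theorem HS_mul_rule (α β γ r₁ r₂ : ℂ) (n k : ℕ) (hk : k ≤ n) :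
    HS α γ (r₁ + r₂) n k = ∑ j ∈ Finset.Icc k n, HS α β r₁ n j * HS β γ r₂ j k := by
  rw [HS_add_eq_sum_range α β]
  symm
  apply Finset.sum_subset
  · intro j hj
    rw [Finset.mem_Icc] at hj
    rw [Finset.mem_range]
    lia
  · intro j hj hj'
    rw [Finset.mem_range] at hj
    rw [Finset.mem_Icc] at hj'
    rw [HS_eq_zero_of_lt β γ r₂ (by lia : j < k), mul_zero]
end

section
/- For all α, β, r ∈ ℂ and all n, k ∈ ℕ with k ≤ n, the generalized Eulerian numbers satisfy the reversal (reflection) identity E_{n,n−k}(α,β;r) = E_{n,k}(−α, β; β − r). -/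
theorem ffall_neg (r α : ℂ) (m : ℕ) : ffall (-r) (-α) m = (-1) ^ m * ffall r α m := by
  have h (i : ℕ) : -r - i * -α = -1 * (r - i * α) := by ring
  simp only [ffall, h, Finset.prod_mul_distrib, Finset.prod_const, Finset.card_range]

/-- The `(n + 1)`-st finite difference of `x ↦ (βx + r)^{\underline{n},α}` vanishes. -/
theorem sum_choose_mul_ffall_eq_zero (α β r : ℂ) (n : ℕ) :
    ∑ m ∈ Finset.range (n + 2),
      (-1) ^ (n + 1 - m) * (Nat.choose (n + 1) m : ℂ) * ffall (β * m + r) α n = 0 := by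
  let P : Polynomial ℂ := ∏ i ∈ Finset.range n,
    (Polynomial.C β * Polynomial.X + Polynomial.C (r - i * α))
  have hdeg : P.natDegree < n + 1 := by
    refine Nat.lt_succ_of_le ((Polynomial.natDegree_prod_le _ _).trans ?_)
    refine (Finset.sum_le_card_nsmul _ _ 1 fun i _ ↦ Polynomial.natDegree_linear_le).trans ?_
    simp
  have heval (x : ℂ) : P.eval x = ffall (β * x + r) α n := by
    simp [P, ffall, Polynomial.eval_prod, add_sub_assoc]
  have h := congrFun (Polynomial.fwdDiff_iter_eq_zero_of_degree_lt hdeg) 0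
  simpa [fwdDiff_iter_eq_sum_shift, heval] using h

/-- Reversal (reflection) identity for the generalized Eulerian numbers:
`E_{n,n−k}(α,β;r) = E_{n,k}(−α, β; β − r)`. -/
theorem Egen_reflection (α β r : ℂ) (n k : ℕ) (hk : k ≤ n) :
    Egen α β r n (n - k) = Egen (-α) β (β - r) n k := by
  obtain ⟨l, rfl⟩ := Nat.exists_eq_add_of_le hk
  have h := sum_choose_mul_ffall_eq_zero α β (r - β * (k + 1)) (k + l)
  rw [show k + l + 2 = (k + 1) + (l + 1) by ring, Finset.sum_range_add,
    ← Finset.sum_range_reflect, add_comm] at h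
  rw [Nat.add_sub_cancel_left, ← sub_eq_zero, ← h, sub_eq_add_neg, Egen, Egen,
    ← Finset.sum_neg_distrib]
  congr 1
  · refine Finset.sum_congr rfl fun y hy ↦ ?_
    have hy : y ≤ l := Nat.lt_succ_iff.1 (Finset.mem_range.1 hy)
    rw [show k + l + 1 - (k + 1 + y) = l - y by omega,
      Nat.choose_symm_of_eq_add (show k + l + 1 = (l - y) + (k + 1 + y) by omega)]
    congr 2
    push_cast
    ring
  · refine Finset.sum_congr rfl fun x hx ↦ ?_
    obtain ⟨z, rfl⟩ := Nat.exists_eq_add_of_le (Nat.lt_succ_iff.1 (Finset.mem_range.1 hx))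
    rw [show x + z + 1 - 1 - x = z by omega, Nat.add_sub_cancel_left,
      show x + z + l + 1 - z = x + l + 1 by omega,
      show β * x + (β - r) = -(β * z + (r - β * ((x + z : ℕ) + 1))) by push_cast; ring,
      ffall_neg]
    have hz : (-1 : ℂ) ^ z * (-1) ^ z = 1 := by rw [← mul_pow]; simp
    simp only [pow_add, pow_one]
    linear_combination (-(-1) ^ x * (-1) ^ l * (Nat.choose (x + z + l + 1) z : ℂ) *
      ffall (β * z + (r - β * ((x + z : ℕ) + 1))) α (x + z + l)) * hz
end

section
/- For all α, β, r ∈ ℂ and all n, k ∈ ℕ, the generalized Eulerian numbers satisfy the two difference equations on the third parameter: E_{n+1,k+1}(α,β; r+α) − E_{n+1,k+1}(α,β; r) = α(n+1) · (E_{n,k+1}(α,β;r) − E_{n,k}(α,β;r)), and E_{n,k}(α,β; r+β) − E_{n,k}(α,β; r) = E_{n,k+1}(α,β;r) − E_{n,k}(α,β;r) + (−1)^k C(n+1, k+1) · (r)^{\underline{n},α}. -/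
theorem ffall_add_stride_sub (r α : ℂ) (n : ℕ) :
    ffall (r + α) α (n + 1) - ffall r α (n + 1) = α * (n + 1) * ffall r α n := by
  have h : ffall (r + α) α (n + 1) = ffall r α n * (r + α) := by
    unfold ffall
    rw [Finset.prod_range_succ']
    congr 1
    · refine Finset.prod_congr rfl fun i _ => ?_
      push_cast
      ring
    · simp
  have h' : ffall r α (n + 1) = ffall r α n * (r - n * α) := Finset.prod_range_succ _ _
  rw [h, h']
  ring

theorem Egen_succ_add_stride_sub (α β r : ℂ) (n k : ℕ) :
    Egen α β (r + α) (n + 1) (k + 1) - Egen α β r (n + 1) (k + 1)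
      = α * (n + 1) * (Egen α β r n (k + 1) - Egen α β r n k) := by
  unfold Egen
  rw [← Finset.sum_sub_distrib]
  simp only [← mul_sub, ← add_assoc, ffall_add_stride_sub]
  rw [Finset.sum_range_succ _ (k + 1), Finset.sum_range_succ _ (k + 1), add_sub_right_comm,
    ← Finset.sum_sub_distrib, mul_add (α * (n + 1 : ℂ)), Finset.mul_sum]
  congr 1
  · refine Finset.sum_congr rfl fun x hx => ?_
    have hk : k + 1 - x = (k - x) + 1 := by
      have := Finset.mem_range.mp hx
      omega
    rw [hk, Nat.choose_succ_succ (n + 1) (k - x)]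
    push_cast
    ring
  · simp

theorem Egen_add_beta (α β r : ℂ) (n k : ℕ) :
    Egen α β (r + β) n k
      = Egen α β r n (k + 1) + (-1) ^ k * (Nat.choose (n + 1) (k + 1) : ℂ) * ffall r α n := by
  unfold Egen
  rw [Finset.sum_range_succ' _ (k + 1)]
  have h : ∀ x : ℕ, β * (x : ℂ) + (r + β) = β * ((x + 1 : ℕ) : ℂ) + r := fun x => by
    push_cast
    ring
  simp only [h, Nat.add_sub_add_right, Nat.sub_zero, Nat.cast_zero, mul_zero, zero_add]
  ring

/-- Difference equations on the third parameter for the generalized Eulerian numbers: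
`E_{n+1,k+1}(r+α) − E_{n+1,k+1}(r) = α(n+1)(E_{n,k+1}(r) − E_{n,k}(r))` and
`E_{n,k}(r+β) − E_{n,k}(r) = E_{n,k+1}(r) − E_{n,k}(r) + (−1)^k C(n+1,k+1) (r)^{\underline{n},α}`. -/
theorem Egen_difference_equations (α β r : ℂ) (n k : ℕ) :
    Egen α β (r + α) (n + 1) (k + 1) - Egen α β r (n + 1) (k + 1)
      = α * (n + 1) * (Egen α β r n (k + 1) - Egen α β r n k) ∧
    Egen α β (r + β) n k - Egen α β r n k
      = Egen α β r n (k + 1) - Egen α β r n k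
        + (-1) ^ k * (Nat.choose (n + 1) (k + 1) : ℂ) * ffall r α n := by
  refine ⟨Egen_succ_add_stride_sub α β r n k, ?_⟩
  rw [Egen_add_beta]
  ring
end

section
/- For all β, r ∈ ℂ and all n, k ∈ ℕ with k ≤ n, one has S_{n,k}(β, β; r) = C(n,k) · (r)^{\underline{n−k},β}, where C(n,k) is the binomial coefficient. -/
/-- `S_{n,k}(β, β; r) = C(n,k) (r)^{\underline{n−k},β}`. -/
theorem HS_beta_beta (β r : ℂ) (n k : ℕ) (hk : k ≤ n) :
    HS β β r n k = (Nat.choose n k : ℂ) * ffall r β (n - k) := by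
  induction n generalizing k with
  | zero =>
    obtain rfl : k = 0 := by omega
    simp [HS, ffall]
  | succ n ih =>
    obtain _ | k := k
    · rw [HS, ih 0 n.zero_le]
      simp only [Nat.choose_zero_right, Nat.sub_zero, ffall_succ]
      ring
    · obtain rfl | hlt := (Nat.le_of_succ_le_succ hk).eq_or_lt
      · rw [HS, HS_eq_zero_of_lt _ _ _ k.lt_succ_self, ih k le_rfl]
        simp
      · obtain ⟨m, rfl⟩ := Nat.exists_eq_add_of_lt hlt
        rw [HS, ih (k + 1) hlt, ih k hlt.le, Nat.choose_succ_succ' (k + m + 1) k,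
          show k + m + 1 - (k + 1) = m by omega, show k + m + 1 - k = m + 1 by omega,
          show k + m + 1 + 1 - (k + 1) = m + 1 by omega, ffall_succ]
        push_cast
        ring
end

section
/- For all β, r ∈ ℂ and all n, k ∈ ℕ with k ≤ n, one has S_{n,k}(−β, β; r) = C(n,k) · (βk + r)^{\overline{n−k},β}, where C(n,k) is the binomial coefficient; in particular (taking β = 1, r = 0) S_{n,k}(−1,1;0) are the unsigned Lah numbers C(n,k)·(k)^{\overline{n−k}}. -/
/-- Rising factorial with stride `α`: `(r)^{\overline{m},α} = ∏_{i=0}^{m-1} (r + iα)`. -/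
noncomputable def frise (r α : ℂ) (m : ℕ) : ℂ := ∏ i ∈ Finset.range m, (r + i * α)

theorem frise_succ_last (x α : ℂ) (m : ℕ) :
    frise x α (m + 1) = frise x α m * (x + m * α) :=
  Finset.prod_range_succ _ _

theorem frise_succ_first (x α : ℂ) (m : ℕ) :
    frise x α (m + 1) = x * frise (x + α) α m := by
  simp only [frise, Finset.prod_range_succ', Nat.cast_zero, zero_mul, add_zero]
  rw [mul_comm]
  congr 1
  refine Finset.prod_congr rfl fun i _ => ?_
  push_cast
  ring

/-- The closed form holds for all `n` and `k`, both sides vanishing when `n < k`. -/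
theorem HS_neg_eq_choose_mul_frise (β r : ℂ) (n k : ℕ) :
    HS (-β) β r n k = (Nat.choose n k : ℂ) * frise (β * k + r) β (n - k) := by
  induction n generalizing k with
  | zero => cases k <;> simp [HS, frise]
  | succ n ih =>
    cases k with
    | zero =>
      rw [HS, ih, Nat.sub_zero, Nat.sub_zero, frise_succ_last]
      simp only [Nat.choose_zero_right, Nat.cast_zero, Nat.cast_one]
      ring
    | succ k =>
      rw [HS, ih, ih, Nat.succ_sub_succ]
      rcases le_or_gt n k with h | h
      · simp [Nat.choose_succ_succ, Nat.choose_eq_zero_of_lt (Nat.lt_succ_of_le h),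
          Nat.sub_eq_zero_of_le h, frise]
      · obtain ⟨m, rfl⟩ := Nat.exists_eq_add_of_lt h
        have hc : ((k + m + 1).choose (k + 1) : ℂ) * (k + 1) =
            (k + m + 1).choose k * (m + 1) := by
          have := Nat.choose_succ_right_eq (k + m + 1) k
          rw [show k + m + 1 - k = m + 1 by omega] at this
          exact_mod_cast this
        have hx : β * (k : ℂ) + r + β = β * ((k + 1 : ℕ) : ℂ) + r := by push_cast; ring
        rw [show k + m + 1 - k = m + 1 by omega, show k + m + 1 - (k + 1) = m by omega,
          frise_succ_first (β * k + r), hx, frise_succ_last, Nat.choose_succ_succ (k + m + 1) k]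
        push_cast
        linear_combination β * frise (β * (k + 1) + r) β m * hc

/-- `S_{n,k}(−β, β; r) = C(n,k) (βk + r)^{\overline{n−k},β}`; in particular
`S_{n,k}(−1,1;0)` are the unsigned Lah numbers `C(n,k) (k)^{\overline{n−k}}`. -/
theorem HS_neg_beta_beta (β r : ℂ) (n k : ℕ) (hk : k ≤ n) :
    HS (-β) β r n k = (Nat.choose n k : ℂ) * frise (β * k + r) β (n - k) ∧
    HS (-1) 1 0 n k = (Nat.choose n k : ℂ) * frise (k : ℂ) 1 (n - k) := by
  refine ⟨HS_neg_eq_choose_mul_frise β r n k, ?_⟩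
  simpa using HS_neg_eq_choose_mul_frise 1 0 n k
end

section
/- For all n, k ∈ ℕ with k ≤ n, the unsigned Bessel numbers of the first kind satisfy the closed form S_{n,k}(−2, −1; 0) = 2^{−(n−k)} · (n)^{\overline{n−k}} · (k)^{\overline{n−k}} / (n−k)!, where (m)^{\overline{j}} = m(m+1)⋯(m+j−1) is the rising factorial; the identity is between complex numbers. -/
theorem frise_succ_mul_factorial (a m : ℕ) :
    frise ((a + 1 : ℕ) : ℂ) 1 m * (Nat.factorial a : ℂ) = (Nat.factorial (a + m) : ℂ) := by
  induction m with
  | zero => simp [frise]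
  | succ m ih =>
    have h : frise ((a + 1 : ℕ) : ℂ) 1 (m + 1)
        = frise ((a + 1 : ℕ) : ℂ) 1 m * (((a + 1 : ℕ) : ℂ) + m * 1) :=
      Finset.prod_range_succ _ _
    rw [h, ← add_assoc, Nat.factorial_succ, Nat.cast_mul, ← ih]
    push_cast
    ring

theorem frise_zero_left_succ (α : ℂ) (m : ℕ) : frise 0 α (m + 1) = 0 :=
  Finset.prod_eq_zero (Finset.mem_range.2 m.succ_pos) (by simp)

theorem HS_zero_right_succ (α β : ℂ) (n : ℕ) : HS α β 0 (n + 1) 0 = 0 := by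
  induction n with
  | zero => simp [HS]
  | succ n ih => rw [HS, ih, mul_zero]

theorem HS_Bessel_mul_factorial (d k : ℕ) :
    HS (-2) (-1) 0 (d + k + 1) (k + 1) * (2 ^ d * Nat.factorial d * Nat.factorial k)
      = (Nat.factorial (2 * d + k) : ℂ) := by
  induction d generalizing k with
  | zero =>
    induction k with
    | zero => simp [HS]
    | succ k ih =>
      rw [HS, HS_eq_zero_of_lt _ _ _ (show 0 + (k + 1) < k + 1 + 1 by omega), mul_zero, zero_add]
      simp only [zero_add, pow_zero, Nat.factorial_zero, Nat.cast_one, one_mul, mul_zero,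
        Nat.factorial_succ k, Nat.cast_mul] at ih ⊢
      linear_combination ((k + 1 : ℕ) : ℂ) * ih
  | succ d ihd =>
    have hfac (k : ℕ) : (Nat.factorial (2 * (d + 1) + k) : ℂ)
        = (2 * d + k + 2) * ((2 * d + k + 1) * Nat.factorial (2 * d + k)) := by
      rw [show 2 * (d + 1) + k = 2 * d + k + 1 + 1 by ring, Nat.factorial_succ, Nat.factorial_succ]
      push_cast
      ring
    induction k with
    | zero =>
      have h := ihd 0
      rw [HS, add_zero, HS_zero_right_succ, hfac, ← h, Nat.factorial_succ]
      push_cast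
      ring_nf
    | succ k ih =>
      have h := ihd (k + 1)
      rw [HS, hfac, ← h]
      rw [hfac] at ih
      have e : d + 1 + (k + 1) = d + (k + 1) + 1 := by ring
      have e' : d + 1 + k + 1 = d + (k + 1) + 1 := by ring
      have hs : (Nat.factorial (2 * d + (k + 1)) : ℂ)
          = (2 * d + k + 1) * Nat.factorial (2 * d + k) := by
        rw [← add_assoc, Nat.factorial_succ]
        push_cast
        ring
      rw [hs] at h
      rw [e'] at ih
      rw [e]
      simp only [Nat.factorial_succ, pow_succ] at h ih ⊢
      push_cast at h ih ⊢
      linear_combination ((k : ℂ) + 1) * ih - ((k : ℂ) + 1) * (2 * d + k + 2) * h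

/-- Closed form for the unsigned Bessel numbers of the first kind:
`S_{n,k}(−2, −1; 0) = 2^{−(n−k)} (n)^{\overline{n−k}} (k)^{\overline{n−k}} / (n−k)!`. -/
theorem HS_Bessel_first_kind (n k : ℕ) (hk : k ≤ n) :
    HS (-2) (-1) 0 n k =
      ((2 : ℂ) ^ (n - k))⁻¹ * frise (n : ℂ) 1 (n - k) * frise (k : ℂ) 1 (n - k)
        / (Nat.factorial (n - k) : ℂ) := by
  obtain ⟨d, rfl⟩ := Nat.exists_eq_add_of_le' hk
  rw [Nat.add_sub_cancel]
  cases k with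
  | zero =>
    cases d with
    | zero => simp [HS, frise]
    | succ d => rw [add_zero, HS_zero_right_succ, Nat.cast_zero, frise_zero_left_succ]; simp
  | succ k =>
    have h := HS_Bessel_mul_factorial d k
    have h₁ := frise_succ_mul_factorial (d + k) d
    have h₂ := frise_succ_mul_factorial k d
    rw [show d + k + d = 2 * d + k by ring] at h₁
    rw [add_comm k d] at h₂
    have hd : (Nat.factorial d : ℂ) ≠ 0 := Nat.cast_ne_zero.2 d.factorial_ne_zero
    have hk : (Nat.factorial k : ℂ) ≠ 0 := Nat.cast_ne_zero.2 k.factorial_ne_zero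
    rw [← add_assoc, eq_div_iff hd, mul_assoc, eq_inv_mul_iff_mul_eq₀ (by simp)]
    apply mul_right_cancel₀ hk
    rw [← h₂] at h₁
    linear_combination h - h₁
end

section
/- For all β, r ∈ ℂ and all n, k ∈ ℕ with k ≤ n, one has E_{n,k}(β, β; r) = C(n,k) · (r)^{\underline{n−k},β} · (βn − r)^{\underline{k},β}, where C(n,k) is the binomial coefficient. -/
theorem ffall_zero (r α : ℂ) : ffall r α 0 = 1 := by
  simp [ffall]

theorem ffall_succ_left (r α : ℂ) (m : ℕ) : ffall (r + α) α (m + 1) = (r + α) * ffall r α m := by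
  rw [ffall, Finset.prod_range_succ', mul_comm, ffall]
  congr 1
  · simp
  · refine Finset.prod_congr rfl fun i _ => ?_
    push_cast
    ring

theorem Egen_zero_right (α β r : ℂ) (n : ℕ) : Egen α β r n 0 = ffall r α n := by
  simp [Egen]

theorem Egen_eq_sum_reflect (α β r : ℂ) (n k : ℕ) :
    Egen α β r n k = ∑ j ∈ Finset.range (k + 1),
      (-1) ^ j * (Nat.choose (n + 1) j : ℂ) * ffall (β * (k - j : ℕ) + r) α n := by
  rw [Egen, ← Finset.sum_range_reflect]
  refine Finset.sum_congr rfl fun j hj => ?_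
  have hjk : j ≤ k := Nat.lt_succ_iff.mp (Finset.mem_range.mp hj)
  rw [Nat.add_sub_cancel, Nat.sub_sub_self hjk]

theorem Egen_zero_succ (α β r : ℂ) (k : ℕ) : Egen α β r 0 (k + 1) = 0 := by
  rw [Egen_eq_sum_reflect, Finset.sum_range_succ', Finset.sum_range_succ', Finset.sum_eq_zero]
  · simp [ffall_zero]
  · intro j _
    rw [Nat.choose_eq_zero_of_lt (by omega)]
    simp

/-- The two-term recurrence of the generalized Eulerian numbers. -/
theorem Egen_succ_succ (α β r : ℂ) (n k : ℕ) :
    Egen α β r (n + 1) (k + 1) =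
      (β * (k + 1) + r - n * α) * Egen α β r n (k + 1) +
        (β * (n + 1 - k) - r + n * α) * Egen α β r n k := by
  simp only [Egen_eq_sum_reflect]
  rw [Finset.sum_range_succ', Finset.sum_range_succ' _ (k + 1), mul_add, Finset.mul_sum,
    Finset.mul_sum, add_right_comm (Finset.sum _ _), ← Finset.sum_add_distrib]
  congr 1
  · refine Finset.sum_congr rfl fun j hj => ?_
    have hjk : j ≤ k := Nat.lt_succ_iff.mp (Finset.mem_range.mp hj)
    have hpascal : (Nat.choose (n + 1 + 1) (j + 1) : ℂ) =
        Nat.choose (n + 1) j + Nat.choose (n + 1) (j + 1) := by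
      exact_mod_cast Nat.choose_succ_succ (n + 1) j
    have habsorb : ((n : ℂ) + 1 + 1) * Nat.choose (n + 1) j =
        Nat.choose (n + 1 + 1) (j + 1) * (j + 1) := by
      exact_mod_cast Nat.add_one_mul_choose_eq (n + 1) j
    rw [hpascal] at habsorb
    rw [Nat.add_sub_add_right, ffall_succ, hpascal, Nat.cast_sub hjk]
    linear_combination (-1) ^ j * ffall (β * (k - j : ℂ) + r) α n * (-β) * habsorb
  · rw [ffall_succ]
    simp
    ring

/-- `E_{n,k}(β, β; r) = C(n,k) (r)^{\underline{n−k},β} (βn − r)^{\underline{k},β}`, with no bound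
on `k`: both sides vanish for `n < k`. -/
theorem Egen_self (β r : ℂ) (n k : ℕ) :
    Egen β β r n k =
      (Nat.choose n k : ℂ) * ffall r β (n - k) * ffall (β * n - r) β k := by
  induction n generalizing k with
  | zero =>
    cases k with
    | zero => simp [Egen_zero_right, ffall_zero]
    | succ k => simp [Egen_zero_succ]
  | succ n ih =>
    cases k with
    | zero => simp [Egen_zero_right, ffall_zero]
    | succ k =>
      have hshift : β * ((n + 1 : ℕ) : ℂ) - r = β * n - r + β := by
        push_cast
        ring
      rw [Egen_succ_succ, ih, ih, hshift, ffall_succ_left, ffall_succ, Nat.add_sub_add_right]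
      rcases lt_trichotomy k n with h | rfl | h
      · obtain ⟨m, rfl⟩ := Nat.exists_eq_add_of_lt h
        have hpascal : (Nat.choose (k + m + 1 + 1) (k + 1) : ℂ) =
            Nat.choose (k + m + 1) k + Nat.choose (k + m + 1) (k + 1) := by
          exact_mod_cast Nat.choose_succ_succ (k + m + 1) k
        have hratio : (Nat.choose (k + m + 1) (k + 1) : ℂ) * (k + 1) =
            Nat.choose (k + m + 1) k * (m + 1) := by
          have := Nat.choose_succ_right_eq (k + m + 1) k
          rw [show k + m + 1 - k = m + 1 by omega] at this
          exact_mod_cast this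
        rw [show k + m + 1 - (k + 1) = m by omega, show k + m + 1 - k = m + 1 by omega,
          ffall_succ r β m, hpascal]
        push_cast
        linear_combination (-β) * ffall r β m * (r - m * β) *
          ffall (β * (k + m + 1) - r) β k * hratio
      · rw [Nat.choose_self, Nat.choose_self, Nat.choose_succ_self, Nat.sub_self, ffall_zero]
        push_cast
        ring
      · simp [Nat.choose_eq_zero_of_lt h, Nat.choose_eq_zero_of_lt (Nat.lt_succ_of_lt h),
          Nat.choose_eq_zero_of_lt (Nat.succ_lt_succ h)]

/-- `E_{n,k}(β, β; r) = C(n,k) (r)^{\underline{n−k},β} (βn − r)^{\underline{k},β}`. -/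
theorem Egen_beta_beta (β r : ℂ) (n k : ℕ) (hk : k ≤ n) :
    Egen β β r n k =
      (Nat.choose n k : ℂ) * ffall r β (n - k) * ffall (β * n - r) β k := by
  exact Egen_self β r n k
end
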